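/- arXiv:2311.02507 — 2 statements merged into one kernel-verified Lean document; each statement's English description precedes it below -/
import Mathlib

section
/- Let μ ≥ 1 and m ≥ 0 be integers and let A be a compact subset of {z ∈ ℂ : Re z > 0}. Then there exist constants C, c > 0 such that for all β ∈ A: (i) |∂_x^m H_{2μ}(β;x)| ≤ C exp(−c|x|^{2μ/(2μ−1)}) for all x ∈ ℝ; (ii) |E_{2μ}(β;x)| ≤ C exp(−c x^{2μ/(2μ−1)}) for all x > 0; (iii) |1 − E_{2μ}(β;x)| ≤ C exp(−c|x|^{2μ/(2μ−1)}) for all x < 0. -/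
open MeasureTheory

/-- The generalized Gaussian `H_{2μ}(β;x) := (1/(2π)) ∫_ℝ e^{ixu} e^{−β u^{2μ}} du`. -/
noncomputable def Hgauss (μ : ℕ) (β : ℂ) (x : ℝ) : ℂ :=
  (1 / (2 * Real.pi)) •
    ∫ u : ℝ, Complex.exp ((x : ℂ) * (u : ℂ) * Complex.I - β * (u : ℂ) ^ (2 * μ))

/-- The generalized Gaussian error function `E_{2μ}(β;x) := ∫_x^{+∞} H_{2μ}(β;y) dy`. -/
noncomputable def Egauss (μ : ℕ) (β : ℂ) (x : ℝ) : ℂ :=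
  ∫ y in Set.Ioi x, Hgauss μ β y

open Complex Filter Topology Set FourierTransform

/-- A power of `u + iη` stays close to the power of `u`, up to a multiple of `η ^ n`. -/
lemma exists_re_mul_add_mul_I_pow_ge {n : ℕ} (hn : Even n) {b B : ℝ} (hb : 0 < b) (hB : 0 < B) :
    ∃ K : ℝ, 0 < K ∧ ∀ β : ℂ, b ≤ β.re → ‖β‖ ≤ B → ∀ u η : ℝ,
      b / 2 * u ^ n - K * η ^ n ≤ (β * ((u : ℂ) + η * I) ^ n).re := by
  have hcont : Continuous fun t : ℝ => ((1 : ℂ) + t * I) ^ n := by fun_prop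
  obtain ⟨δ, hδ, hδt⟩ := Metric.continuous_iff.1 hcont 0 (b / (2 * B)) (by positivity)
  refine ⟨B * (2 / δ + 1) ^ n + b / 2 * (2 / δ) ^ n, by positivity, fun β hβ hβB u η => ?_⟩
  have hun : 0 ≤ u ^ n := hn.pow_nonneg u
  have hηn : 0 ≤ η ^ n := hn.pow_nonneg η
  by_cases h : |η| < δ * |u|
  · have hu : u ≠ 0 := by
      rintro rfl
      simp only [abs_zero, mul_zero] at h
      exact absurd h (abs_nonneg η).not_gt
    have ht := hδt (η / u) (by
      rw [dist_zero_right, Real.norm_eq_abs, abs_div, div_lt_iff₀ (abs_pos.2 hu)]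
      exact h)
    set w : ℂ := ((1 : ℂ) + (η / u : ℝ) * I) ^ n with hw
    have hw1 : ‖w - 1‖ ≤ b / (2 * B) := by
      simpa [dist_eq_norm] using ht.le
    have hfac : ((u : ℂ) + η * I) ^ n = ((u ^ n : ℝ) : ℂ) * w := by
      have huC : (u : ℂ) ≠ 0 := by exact_mod_cast hu
      rw [hw]
      push_cast
      rw [← mul_pow]
      congr 1
      field_simp
    have hre : -(b / 2) ≤ (β * (w - 1)).re := by
      have h1 : ‖β * (w - 1)‖ ≤ b / 2 := by
        rw [norm_mul]
        calc ‖β‖ * ‖w - 1‖ ≤ B * (b / (2 * B)) := by gcongr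
          _ = b / 2 := by field_simp
      linarith [neg_le_of_abs_le (abs_re_le_norm (β * (w - 1)))]
    have hmain : b / 2 ≤ (β * w).re := by
      have : β * w = β + β * (w - 1) := by ring
      rw [this, add_re]
      linarith
    have hsplit : (β * ((u : ℂ) + η * I) ^ n).re = u ^ n * (β * w).re := by
      rw [hfac, mul_left_comm, re_ofReal_mul]
    rw [hsplit]
    have hK : 0 ≤ (B * (2 / δ + 1) ^ n + b / 2 * (2 / δ) ^ n) * η ^ n := by positivity
    nlinarith [mul_le_mul_of_nonneg_left hmain hun]
  · have hu : |u| ≤ 2 / δ * |η| := by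
      rw [div_mul_eq_mul_div, le_div_iff₀ hδ]
      linarith [abs_nonneg η]
    have hup : u ^ n ≤ (2 / δ) ^ n * η ^ n := by
      rw [← hn.pow_abs u, ← hn.pow_abs η, ← mul_pow]
      gcongr
    have hnorm : ‖β * ((u : ℂ) + η * I) ^ n‖ ≤ B * ((2 / δ + 1) ^ n * η ^ n) := by
      rw [norm_mul, norm_pow, ← hn.pow_abs η, ← mul_pow]
      gcongr
      calc ‖(u : ℂ) + η * I‖ ≤ |u| + |η| := by
            refine (norm_add_le _ _).trans ?_
            simp
        _ ≤ (2 / δ + 1) * |η| := by linarith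
    have h2 := neg_le_of_abs_le ((abs_re_le_norm (β * ((u : ℂ) + η * I) ^ n)).trans hnorm)
    have h3 := mul_le_mul_of_nonneg_left hup (half_pos hb).le
    linarith

/-- Gaussian domination of `z ^ m * exp (-β z ^ n)` on horizontal lines. -/
lemma exists_norm_pow_mul_exp_le {n : ℕ} (hn : Even n) (hn0 : n ≠ 0) (m : ℕ) {b B : ℝ}
    (hb : 0 < b) (hB : 0 < B) :
    ∃ M K a : ℝ, 0 < M ∧ 0 < K ∧ 0 < a ∧ ∀ β : ℂ, b ≤ β.re → ‖β‖ ≤ B → ∀ u η : ℝ,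
      ‖((u : ℂ) + η * I) ^ m * cexp (-β * ((u : ℂ) + η * I) ^ n)‖ ≤
        M * Real.exp (K * η ^ n) * Real.exp (-a * u ^ 2) := by
  obtain ⟨K, hK, hle⟩ := exists_re_mul_add_mul_I_pow_ge hn hb hB
  refine ⟨m.factorial * Real.exp (3 + b / 2 + 2 / b), K + 1, b / 4, by positivity, by positivity,
    by positivity, fun β hβ hβB u η => ?_⟩
  have hsq : ∀ t : ℝ, t ^ 2 ≤ 1 + t ^ n := by
    intro t
    have h2n : 2 ≤ n := by
      obtain ⟨k, rfl⟩ := hn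
      omega
    rw [← sq_abs, ← hn.pow_abs]
    rcases le_total |t| 1 with h | h
    · have := pow_le_one₀ (n := 2) (abs_nonneg t) h
      have := pow_nonneg (abs_nonneg t) n
      linarith
    · have := pow_le_pow_right₀ h h2n
      linarith
  have hpow : ‖(u : ℂ) + η * I‖ ^ m ≤ m.factorial * Real.exp (|u| + |η|) := by
    have h1 : ‖(u : ℂ) + η * I‖ ≤ |u| + |η| := by
      refine (norm_add_le _ _).trans ?_
      simp
    have h2 := Real.pow_div_factorial_le_exp (|u| + |η|) (by positivity) m
    rw [div_le_iff₀ (by positivity)] at h2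
    calc _ ≤ (|u| + |η|) ^ m := by gcongr
      _ ≤ _ := by linarith
  have hη : |η| ≤ 2 + η ^ n := by
    have := hsq η
    nlinarith [sq_abs η, sq_nonneg (|η| - 1)]
  have hu : |u| ≤ b / 4 * u ^ 2 + 1 / b := by
    have : b / 4 * u ^ 2 + 1 / b - |u| = (b / 2 * |u| - 1) ^ 2 / b := by
      rw [← sq_abs u]
      field_simp
      ring
    have : 0 ≤ (b / 2 * |u| - 1) ^ 2 / b := by positivity
    linarith
  have hu2 := mul_le_mul_of_nonneg_left (hsq u) (half_pos hb).le
  have h1b : 0 < 1 / b := by positivity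
  rw [norm_mul, norm_pow, norm_exp, mul_assoc, mul_assoc, ← Real.exp_add, ← Real.exp_add]
  calc _ ≤ m.factorial * Real.exp (|u| + |η|) * Real.exp (-(b / 2 * u ^ n - K * η ^ n)) := by
        gcongr
        rw [neg_mul, neg_re]
        exact neg_le_neg (hle β hβ hβB u η)
    _ = m.factorial * Real.exp (|u| + |η| + -(b / 2 * u ^ n - K * η ^ n)) := by
        rw [mul_assoc, ← Real.exp_add]
    _ ≤ _ := by
        refine mul_le_mul_of_nonneg_left (Real.exp_le_exp.2 ?_) (by positivity)
        have : 2 / b = 2 * (1 / b) := by ring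
        linarith

/-- Horizontal shift of the contour for entire functions with Gaussian decay on a strip. -/
lemma integral_eq_integral_add_mul_I {g : ℂ → ℂ} (hg : Differentiable ℂ g) {M a : ℝ} (ha : 0 < a)
    (η : ℝ) (hM : ∀ t ∈ uIcc 0 η, ∀ u : ℝ, ‖g ((u : ℂ) + t * I)‖ ≤ M * Real.exp (-a * u ^ 2)) :
    ∫ u : ℝ, g u = ∫ u : ℝ, g ((u : ℂ) + η * I) := by
  have hgc := hg.continuous
  have hint : ∀ t ∈ uIcc 0 η, Integrable fun u : ℝ => g ((u : ℂ) + t * I) := fun t ht =>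
    ((integrable_exp_neg_mul_sq ha).const_mul M).mono'
      (by fun_prop) (ae_of_all _ (hM t ht))
  have hint0 : Integrable fun u : ℝ => g (u : ℂ) := by
    simpa using hint 0 left_mem_uIcc
  have hexp : Tendsto (fun T : ℝ => M * Real.exp (-a * T ^ 2) * |η - 0|) atTop (𝓝 0) := by
    have h1 : Tendsto (fun T : ℝ => -a * T ^ 2) atTop atBot :=
      (tendsto_pow_atTop two_ne_zero).const_mul_atTop_of_neg (neg_lt_zero.2 ha)
    simpa using ((Real.tendsto_exp_atBot.comp h1).const_mul M).mul_const |η - 0|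
  have hvert : ∀ s : ℝ → ℝ, (∀ T, s T ^ 2 = T ^ 2) →
      Tendsto (fun T : ℝ => ∫ y : ℝ in (0 : ℝ)..η, g ((s T : ℂ) + y * I)) atTop (𝓝 0) := by
    intro s hs
    refine squeeze_zero_norm (fun T => ?_) hexp
    refine intervalIntegral.norm_integral_le_of_norm_le_const fun y hy => ?_
    simpa [hs T] using hM y (uIoc_subset_uIcc hy) (s T)
  have hleft := intervalIntegral_tendsto_integral hint0 tendsto_neg_atTop_atBot tendsto_id
  have hright := intervalIntegral_tendsto_integral (hint η right_mem_uIcc)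
    tendsto_neg_atTop_atBot tendsto_id
  have hlim := ((hleft.sub hright).add ((hvert id fun _ => rfl).const_smul I)).sub
    ((hvert Neg.neg fun T => by ring).const_smul I)
  have hzero : ∀ T : ℝ, (∫ x : ℝ in -T..id T, g x) - (∫ x : ℝ in -T..id T, g ((x : ℂ) + η * I)) +
      I • (∫ y : ℝ in (0 : ℝ)..η, g ((id T : ℝ) + y * I)) -
      I • (∫ y : ℝ in (0 : ℝ)..η, g ((-T : ℝ) + y * I)) = 0 := by
    intro T
    have := integral_boundary_rect_eq_zero_of_differentiableOn g (-T : ℂ) (T + η * I)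
      hg.differentiableOn
    simpa using this
  have hunique := tendsto_nhds_unique hlim (tendsto_const_nhds.congr fun T => (hzero T).symm)
  rw [smul_zero, sub_zero, add_zero, sub_eq_zero] at hunique
  exact hunique

lemma Hgauss_eq_fourier (μ : ℕ) (β : ℂ) :
    Hgauss μ β = fun x : ℝ => (1 / (2 * Real.pi)) •
      𝓕 (fun u : ℝ => cexp (-β * (u : ℂ) ^ (2 * μ))) (-(1 / (2 * Real.pi)) * x) := by
  ext x
  rw [Hgauss, Real.fourier_real_eq_integral_exp_smul]
  congr 2
  ext u
  rw [smul_eq_mul, ← Complex.exp_add]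
  congr 1
  have : (Real.pi : ℂ) ≠ 0 := by exact_mod_cast Real.pi_ne_zero
  push_cast
  field_simp
  ring

lemma integrable_pow_mul_exp_neg_mul_pow {n : ℕ} (hn : Even n) (hn0 : n ≠ 0) {β : ℂ}
    (hβ : 0 < β.re) (m : ℕ) :
    Integrable fun u : ℝ => (u : ℂ) ^ m * cexp (-β * (u : ℂ) ^ n) := by
  obtain ⟨M, K, a, -, -, ha, h⟩ := exists_norm_pow_mul_exp_le hn hn0 m hβ
    (hβ.trans_le (re_le_norm β))
  refine ((integrable_exp_neg_mul_sq ha).const_mul M).mono' (by fun_prop) (ae_of_all _ fun u => ?_)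
  simpa [hn0] using h β le_rfl le_rfl u 0

lemma iteratedDeriv_Hgauss {μ : ℕ} (hμ : 1 ≤ μ) {β : ℂ} (hβ : 0 < β.re) (m : ℕ) (x : ℝ) :
    iteratedDeriv m (Hgauss μ β) x = (1 / (2 * Real.pi)) •
      ∫ u : ℝ, (I * u) ^ m * cexp (x * u * I - β * (u : ℂ) ^ (2 * μ)) := by
  have hint : ∀ k : ℕ, Integrable fun u : ℝ => (u : ℂ) ^ k * cexp (-β * (u : ℂ) ^ (2 * μ)) :=
    integrable_pow_mul_exp_neg_mul_pow (even_two_mul μ) (by omega) hβ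
  have hcd : ContDiff ℝ m (𝓕 fun u : ℝ => cexp (-β * (u : ℂ) ^ (2 * μ))) := by
    have := Real.contDiff_fourier (N := (m : ℕ∞))
      (f := fun u : ℝ => cexp (-β * (u : ℂ) ^ (2 * μ))) (fun k _ => by
        simpa using (hint k).norm)
    exact_mod_cast this
  have hF := Real.iteratedDeriv_fourier (N := (m : ℕ∞)) (n := m)
      (f := fun u : ℝ => cexp (-β * (u : ℂ) ^ (2 * μ))) (fun k _ => by
        simpa using hint k) le_rfl
  rw [Hgauss_eq_fourier, iteratedDeriv_fun_const_smul_field]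
  congr 1
  rw [iteratedDeriv_comp_const_smul hcd, hF]
  beta_reduce
  rw [Real.fourier_real_eq_integral_exp_smul, ← integral_smul]
  congr 1
  ext u
  have : (Real.pi : ℂ) ≠ 0 := by exact_mod_cast Real.pi_ne_zero
  rw [smul_eq_mul, smul_eq_mul, real_smul, mul_left_comm (cexp _), ← Complex.exp_add, ← mul_assoc]
  push_cast
  rw [← mul_pow]
  congr 2
  · field_simp
  · field_simp
    ring

/-- The bound obtained by moving the contour to the line `Im z = η`. -/
lemma exists_norm_iteratedDeriv_Hgauss_le {μ : ℕ} (hμ : 1 ≤ μ) (m : ℕ) {b B : ℝ}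
    (hb : 0 < b) (hB : 0 < B) :
    ∃ C K : ℝ, 0 < C ∧ 0 < K ∧ ∀ β : ℂ, b ≤ β.re → ‖β‖ ≤ B → ∀ x η : ℝ,
      ‖iteratedDeriv m (Hgauss μ β) x‖ ≤ C * Real.exp (K * η ^ (2 * μ) - x * η) := by
  have heven := even_two_mul μ
  obtain ⟨M, K, a, hM, hK, ha, h⟩ := exists_norm_pow_mul_exp_le heven (by omega) m hb hB
  refine ⟨1 / (2 * Real.pi) * (M * √(Real.pi / a)), K, by positivity, hK,
    fun β hβ hβB x η => ?_⟩
  set g : ℂ → ℂ := fun z => (I * z) ^ m * cexp (x * z * I - β * z ^ (2 * μ)) with hg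
  have hgd : Differentiable ℂ g := by fun_prop
  have hbound : ∀ t u : ℝ, ‖g ((u : ℂ) + t * I)‖ ≤
      M * Real.exp (K * t ^ (2 * μ) - x * t) * Real.exp (-a * u ^ 2) := by
    intro t u
    have hsplit : g ((u : ℂ) + t * I) = I ^ m * cexp (x * (u + t * I) * I) *
        (((u : ℂ) + t * I) ^ m * cexp (-β * ((u : ℂ) + t * I) ^ (2 * μ))) := by
      simp only [hg]
      rw [sub_eq_add_neg, Complex.exp_add, mul_pow, neg_mul]
      ring
    have hre : ((x : ℂ) * (u + t * I) * I).re = -(x * t) := by simp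
    rw [hsplit, norm_mul, norm_mul, norm_pow, norm_I, one_pow, one_mul, norm_exp, hre]
    calc _ ≤ Real.exp (-(x * t)) * (M * Real.exp (K * t ^ (2 * μ)) * Real.exp (-a * u ^ 2)) := by
          gcongr
          exact h β hβ hβB u t
      _ = _ := by
          rw [sub_eq_add_neg, Real.exp_add]
          ring
  have hshift := integral_eq_integral_add_mul_I hgd ha η
    (M := M * Real.exp (K * η ^ (2 * μ) + |x| * |η|)) fun t ht u => by
      refine (hbound t u).trans ?_
      have htη : |t| ≤ |η| := by
        simpa using abs_sub_left_of_mem_uIcc ht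
      have h1 : t ^ (2 * μ) ≤ η ^ (2 * μ) := by
        rw [← heven.pow_abs t, ← heven.pow_abs η]
        gcongr
      have h2 : -(x * t) ≤ |x| * |η| :=
        (neg_le_abs _).trans (by rw [abs_mul]; gcongr)
      have h3 := mul_le_mul_of_nonneg_left h1 hK.le
      gcongr ?_ * Real.exp ?_ * _
      linarith
  rw [iteratedDeriv_Hgauss hμ (hb.trans_le hβ), norm_smul, Real.norm_of_nonneg (by positivity),
    mul_assoc]
  gcongr
  rw [show ∫ u : ℝ, (I * u) ^ m * cexp (x * u * I - β * (u : ℂ) ^ (2 * μ)) = ∫ u : ℝ, g u from rfl,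
    hshift]
  refine (norm_integral_le_of_norm_le ((integrable_exp_neg_mul_sq ha).const_mul _)
    (ae_of_all _ (hbound η))).trans_eq ?_
  rw [integral_const_mul, integral_gaussian]
  ring

/-- Choice of the optimal height of the contour. -/
lemma exists_mul_pow_sub_mul_le {n : ℕ} (hn : Even n) (hn0 : n ≠ 0) {K : ℝ} (hK : 0 < K) :
    ∃ c : ℝ, 0 < c ∧ ∀ x : ℝ, ∃ η : ℝ,
      K * η ^ n - x * η ≤ -c * |x| ^ ((n : ℝ) / ((n : ℝ) - 1)) := by
  have h2n : 2 ≤ n := by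
    obtain ⟨k, rfl⟩ := hn
    omega
  have h2n' : (2 : ℝ) ≤ n := by exact_mod_cast h2n
  have hn1 : (n : ℝ) - 1 ≠ 0 := by linarith
  refine ⟨(1 / (2 * K)) ^ (1 / ((n : ℝ) - 1)) / 2, by positivity, fun x => ?_⟩
  set r : ℝ := (|x| / (2 * K)) ^ (1 / ((n : ℝ) - 1)) with hr
  have hr0 : 0 ≤ r := by positivity
  have hrn : r ^ n = |x| / (2 * K) * r := by
    obtain ⟨k, rfl⟩ : ∃ k, n = k + 1 := ⟨n - 1, by omega⟩
    rw [pow_succ, hr, ← Real.rpow_natCast, ← Real.rpow_mul (by positivity)]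
    have : 1 / (((k + 1 : ℕ) : ℝ) - 1) * k = 1 := by
      push_cast at hn1 ⊢
      rw [add_sub_cancel_right] at hn1 ⊢
      field_simp
    rw [this, Real.rpow_one]
  have hval : K * r ^ n - |x| * r =
      -((1 / (2 * K)) ^ (1 / ((n : ℝ) - 1)) / 2) * |x| ^ ((n : ℝ) / ((n : ℝ) - 1)) := by
    have hexp : (n : ℝ) / ((n : ℝ) - 1) = 1 + 1 / ((n : ℝ) - 1) := by
      field_simp
      ring
    have hr' : r = (1 / (2 * K)) ^ (1 / ((n : ℝ) - 1)) * |x| ^ (1 / ((n : ℝ) - 1)) := by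
      rw [hr, ← Real.mul_rpow (by positivity) (by positivity)]
      congr 1
      ring
    have hxp : |x| ^ ((n : ℝ) / ((n : ℝ) - 1)) = |x| * |x| ^ (1 / ((n : ℝ) - 1)) := by
      have : 0 < 1 / ((n : ℝ) - 1) := by
        apply one_div_pos.2
        linarith
      rw [hexp, Real.rpow_add_of_nonneg (abs_nonneg x) zero_le_one this.le, Real.rpow_one]
    rw [hrn, hxp]
    have : K * (|x| / (2 * K) * r) - |x| * r = -(|x| * r / 2) := by
      field_simp
      ring
    rw [this, hr']
    ring
  rcases le_total 0 x with hx | hx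
  · refine ⟨r, ?_⟩
    rw [← hval, abs_of_nonneg hx]
  · refine ⟨-r, ?_⟩
    rw [← hval, abs_of_nonpos hx, hn.neg_pow]
    linarith

lemma exists_norm_iteratedDeriv_Hgauss_le_exp_rpow {μ : ℕ} (hμ : 1 ≤ μ) (m : ℕ) {b B : ℝ}
    (hb : 0 < b) (hB : 0 < B) :
    ∃ C c : ℝ, 0 < C ∧ 0 < c ∧ ∀ β : ℂ, b ≤ β.re → ‖β‖ ≤ B → ∀ x : ℝ,
      ‖iteratedDeriv m (Hgauss μ β) x‖ ≤
        C * Real.exp (-c * |x| ^ ((2 * (μ : ℝ)) / (2 * (μ : ℝ) - 1))) := by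
  obtain ⟨C, K, hC, hK, h⟩ := exists_norm_iteratedDeriv_Hgauss_le hμ m hb hB
  obtain ⟨c, hc, hη⟩ := exists_mul_pow_sub_mul_le (even_two_mul μ) (by omega) hK
  refine ⟨C, c, hC, hc, fun β hβ hβB x => ?_⟩
  obtain ⟨η, hle⟩ := hη x
  push_cast at hle
  exact (h β hβ hβB x η).trans (by gcongr)

lemma exp_neg_mul_rpow_le {c p t : ℝ} (hc : 0 < c) (hp : 1 ≤ p) (ht : 0 ≤ t) :
    Real.exp (-c * t ^ p) ≤ Real.exp c * Real.exp (-c * t) := by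
  rw [← Real.exp_add]
  gcongr
  have : t - 1 ≤ t ^ p := by
    rcases le_total t 1 with h | h
    · linarith [Real.rpow_nonneg ht p]
    · linarith [Real.self_le_rpow_of_one_le h hp]
  nlinarith

/-- Tail integrals of a function inherit its stretched exponential decay. -/
lemma norm_integral_Ioi_le_of_exp_rpow {f : ℝ → ℂ} {C c p : ℝ} (hC : 0 ≤ C) (hc : 0 < c)
    (hp : 1 ≤ p) (hf : ∀ y : ℝ, 0 < y → ‖f y‖ ≤ C * Real.exp (-c * y ^ p)) {x : ℝ} (hx : 0 < x) :
    ‖∫ y in Ioi x, f y‖ ≤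
      C * Real.exp (c / 2) * (2 / c) * Real.exp (-(c / 2) * x ^ p) := by
  have hc2 : -(c / 2) < 0 := by linarith
  have hbound : ∀ y ∈ Ioi x, ‖f y‖ ≤
      C * Real.exp (c / 2) * Real.exp (-(c / 2) * x ^ p) * Real.exp (-(c / 2) * y) := by
    intro y hy
    have hy0 : 0 < y := hx.trans hy
    have hxy : x ^ p ≤ y ^ p := Real.rpow_le_rpow hx.le (le_of_lt hy) (by linarith)
    calc ‖f y‖ ≤ C * Real.exp (-c * y ^ p) := hf y hy0
      _ = C * (Real.exp (-(c / 2) * y ^ p) * Real.exp (-(c / 2) * y ^ p)) := by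
          rw [← Real.exp_add]
          ring_nf
      _ ≤ C * (Real.exp (-(c / 2) * x ^ p) * (Real.exp (c / 2) * Real.exp (-(c / 2) * y))) := by
          have h1 : Real.exp (-(c / 2) * y ^ p) ≤ Real.exp (-(c / 2) * x ^ p) :=
            Real.exp_le_exp.2 (mul_le_mul_of_nonpos_left hxy hc2.le)
          have h2 := exp_neg_mul_rpow_le (half_pos hc) hp hy0.le
          gcongr
      _ = _ := by ring
  have hint : IntegrableOn (fun y : ℝ => Real.exp (-(c / 2) * y)) (Ioi x) :=
    integrableOn_exp_mul_Ioi hc2 x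
  refine (norm_integral_le_of_norm_le (hint.const_mul _)
    (ae_restrict_of_forall_mem measurableSet_Ioi hbound)).trans ?_
  rw [integral_const_mul, integral_exp_mul_Ioi hc2]
  have h1 : -Real.exp (-(c / 2) * x) / -(c / 2) ≤ 2 / c := by
    rw [neg_div_neg_eq, div_le_div_iff₀ (half_pos hc) hc]
    have : Real.exp (-(c / 2) * x) ≤ 1 := Real.exp_le_one_iff.2 (by nlinarith)
    nlinarith
  calc _ ≤ C * Real.exp (c / 2) * Real.exp (-(c / 2) * x ^ p) * (2 / c) := by gcongr
    _ = _ := by ring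

lemma one_le_two_mul_div_sub_one {μ : ℕ} (hμ : 1 ≤ μ) :
    1 ≤ (2 * (μ : ℝ)) / (2 * (μ : ℝ) - 1) := by
  have : (1 : ℝ) ≤ μ := by exact_mod_cast hμ
  rw [le_div_iff₀ (by linarith)]
  linarith

lemma integrable_exp_neg_mul_abs {c : ℝ} (hc : 0 < c) :
    Integrable fun x : ℝ => Real.exp (-c * |x|) := by
  rw [← integrableOn_univ, ← Iic_union_Ioi (a := (0 : ℝ))]
  refine IntegrableOn.union ?_ ?_
  · refine (integrableOn_exp_mul_Iic hc 0).congr_fun (fun x hx => ?_) measurableSet_Iic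
    simp [abs_of_nonpos (mem_Iic.1 hx)]
  · refine (integrableOn_exp_mul_Ioi (neg_lt_zero.2 hc) 0).congr_fun (fun x hx => ?_)
      measurableSet_Ioi
    simp [abs_of_pos (mem_Ioi.1 hx)]

lemma integrable_Hgauss {μ : ℕ} (hμ : 1 ≤ μ) {β : ℂ} (hβ : 0 < β.re) :
    Integrable (Hgauss μ β) := by
  obtain ⟨C, c, hC, hc, h⟩ := exists_norm_iteratedDeriv_Hgauss_le_exp_rpow hμ 0 hβ
    (hβ.trans_le (re_le_norm β))
  have hcont : Continuous (Hgauss μ β) := by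
    rw [Hgauss_eq_fourier]
    have : Continuous (𝓕 fun u : ℝ => cexp (-β * (u : ℂ) ^ (2 * μ))) := by
      refine VectorFourier.fourierIntegral_continuous Real.continuous_fourierChar
        (by exact continuous_inner) ?_
      simpa using integrable_pow_mul_exp_neg_mul_pow (even_two_mul μ) (by omega) hβ 0
    fun_prop
  have hmaj : Integrable fun x : ℝ => C * (Real.exp c * Real.exp (-c * |x|)) :=
    ((integrable_exp_neg_mul_abs hc).const_mul _).const_mul _
  refine hmaj.mono' hcont.aestronglyMeasurable (ae_of_all _ fun x => ?_)
  have := h β le_rfl le_rfl x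
  rw [iteratedDeriv_zero] at this
  exact this.trans (by
    gcongr
    exact exp_neg_mul_rpow_le hc (one_le_two_mul_div_sub_one hμ) (abs_nonneg x))

lemma integral_Hgauss {μ : ℕ} (hμ : 1 ≤ μ) {β : ℂ} (hβ : 0 < β.re) :
    ∫ x, Hgauss μ β x = 1 := by
  set f : ℝ → ℂ := fun u => cexp (-β * (u : ℂ) ^ (2 * μ)) with hf
  have hpi : -(1 / (2 * Real.pi)) ≠ 0 := by
    have := Real.pi_pos
    exact neg_ne_zero.2 (by positivity)
  have hfint : Integrable f := by
    simpa [hf] using integrable_pow_mul_exp_neg_mul_pow (even_two_mul μ) (by omega) hβ 0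
  have hFint : Integrable (𝓕 f) := by
    have := integrable_Hgauss hμ hβ
    rw [Hgauss_eq_fourier] at this
    rwa [integrable_fun_smul_iff (neg_ne_zero.1 hpi), integrable_comp_mul_left_iff _ hpi] at this
  have hinv := hfint.fourierInv_fourier_eq hFint (v := 0) (by fun_prop)
  rw [Real.fourierInv_eq] at hinv
  rw [Hgauss_eq_fourier, integral_smul, Measure.integral_comp_mul_left]
  simp only [inner_zero_right, AddChar.map_zero_eq_one, one_smul] at hinv
  rw [hinv, smul_smul, inv_neg, abs_neg, abs_of_nonneg (by positivity), mul_inv_cancel₀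
    (neg_ne_zero.1 hpi), one_smul]
  have : 2 * μ ≠ 0 := by omega
  simp [hf, this]

lemma one_sub_Egauss {μ : ℕ} (hμ : 1 ≤ μ) {β : ℂ} (hβ : 0 < β.re) (x : ℝ) :
    1 - Egauss μ β x = ∫ y in Ioi (-x), Hgauss μ β (-y) := by
  have h := integrable_Hgauss hμ hβ
  rw [integral_comp_neg_Ioi, neg_neg, Egauss, ← integral_Hgauss hμ hβ,
    ← intervalIntegral.integral_Iic_add_Ioi (b := x) h.integrableOn h.integrableOn,
    add_sub_cancel_right]

theorem stmt0 (μ m : ℕ) (hμ : 1 ≤ μ) (A : Set ℂ) (hA : IsCompact A)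
    (hA' : A ⊆ {z : ℂ | 0 < z.re}) :
    ∃ C c : ℝ, 0 < C ∧ 0 < c ∧ ∀ β ∈ A,
      (∀ x : ℝ, ‖iteratedDeriv m (Hgauss μ β) x‖ ≤
        C * Real.exp (-c * |x| ^ ((2 * (μ : ℝ)) / (2 * (μ : ℝ) - 1)))) ∧
      (∀ x : ℝ, 0 < x → ‖Egauss μ β x‖ ≤
        C * Real.exp (-c * x ^ ((2 * (μ : ℝ)) / (2 * (μ : ℝ) - 1)))) ∧
      (∀ x : ℝ, x < 0 → ‖1 - Egauss μ β x‖ ≤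
        C * Real.exp (-c * |x| ^ ((2 * (μ : ℝ)) / (2 * (μ : ℝ) - 1)))) := by
  obtain ⟨b, hb, hbA⟩ := hA.exists_forall_le' continuous_re.continuousOn (a := 0) hA'
  obtain ⟨B, hB, hBA⟩ := hA.isBounded.exists_pos_norm_le
  obtain ⟨C₁, c₁, hC₁, hc₁, h₁⟩ := exists_norm_iteratedDeriv_Hgauss_le_exp_rpow hμ m hb hB
  obtain ⟨C₂, c₂, hC₂, hc₂, h₂⟩ := exists_norm_iteratedDeriv_Hgauss_le_exp_rpow hμ 0 hb hB
  simp only [iteratedDeriv_zero] at h₂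
  set p : ℝ := (2 * (μ : ℝ)) / (2 * (μ : ℝ) - 1) with hp
  have hp1 : 1 ≤ p := one_le_two_mul_div_sub_one hμ
  set C₃ : ℝ := C₂ * Real.exp (c₂ / 2) * (2 / c₂) with hC₃
  have hweaken : ∀ {D d t : ℝ}, 0 ≤ D → D ≤ max C₁ C₃ → min c₁ (c₂ / 2) ≤ d → 0 ≤ t →
      D * Real.exp (-d * t ^ p) ≤ max C₁ C₃ * Real.exp (-min c₁ (c₂ / 2) * t ^ p) := by
    intro D d t hD hDC hd ht
    have := Real.rpow_nonneg ht p
    gcongr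
  refine ⟨max C₁ C₃, min c₁ (c₂ / 2), lt_max_of_lt_left hC₁, lt_min hc₁ (half_pos hc₂),
    fun β hβ => ⟨fun x => ?_, fun x hx => ?_, fun x hx => ?_⟩⟩
  · exact (h₁ β (hbA β hβ) (hBA β hβ) x).trans
      (hweaken hC₁.le (le_max_left _ _) (min_le_left _ _) (abs_nonneg x))
  · refine (norm_integral_Ioi_le_of_exp_rpow hC₂.le hc₂ hp1 (fun y hy => ?_) hx).trans
      (hweaken (by positivity) (le_max_right _ _) (min_le_right _ _) hx.le)
    simpa [abs_of_pos hy] using h₂ β (hbA β hβ) (hBA β hβ) y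
  · rw [one_sub_Egauss hμ (hA' hβ), abs_of_neg hx]
    refine (norm_integral_Ioi_le_of_exp_rpow hC₂.le hc₂ hp1 (fun y hy => ?_)
      (neg_pos.2 hx)).trans
      (hweaken (by positivity) (le_max_right _ _) (min_le_right _ _) (neg_pos.2 hx).le)
    simpa [abs_of_pos hy] using h₂ β (hbA β hβ) (hBA β hβ) (-y)
end

section
/- Let N ≥ 1, let (M_j)_{j∈ℤ} be a sequence of invertible matrices in M_N(ℂ), let M ∈ M_N(ℂ) be invertible, and let C₀, a > 0 satisfy ‖M_j − M‖ ≤ C₀ e^{−a j} for all j ∈ ℕ. Let ζ ∈ ℂ\{0} be an eigenvalue of M and R ∈ ℂ^N \ {0} with M R = ζ R. Then there exist constants C, c > 0 and a sequence (W_j)_{j∈ℤ} in ℂ^N such that W_{j+1} = M_j W_j for all j ∈ ℤ and |ζ^{−j} W_j − R| ≤ C e^{−c j} for all j ∈ ℕ. -/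
attribute [local instance] Matrix.linftyOpNormedRing

/-- If `S` has a right inverse, both contractions, then `r • S - z` has a right inverse whenever
`‖z‖ ≠ ‖r‖`. -/
theorem exists_smul_sub_algebraMap_mul_eq_one {𝒜 : Type*} [NormedRing 𝒜] [NormedAlgebra ℂ 𝒜]
    [CompleteSpace 𝒜] {S T : 𝒜} (hST : S * T = 1) (hS : ‖S‖ ≤ 1) (hT : ‖T‖ ≤ 1)
    {r z : ℂ} (hr : r ≠ 0) (hz : ‖z‖ ≠ ‖r‖) :
    ∃ G : 𝒜, (r • S - algebraMap ℂ 𝒜 z) * G = 1 := by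
  rcases lt_or_gt_of_ne hz with h | h
  · have hlt : ‖(z / r) • T‖ < 1 := by
      calc ‖(z / r) • T‖ ≤ ‖z / r‖ * ‖T‖ := norm_smul_le _ _
        _ ≤ ‖z / r‖ * 1 := by gcongr
        _ < 1 := by
          rw [mul_one, norm_div, div_lt_one (norm_pos_iff.mpr hr)]
          exact h
    obtain ⟨u, hu⟩ := isUnit_one_sub_of_norm_lt_one hlt
    refine ⟨(r⁻¹ • T) * (u⁻¹ : 𝒜ˣ), ?_⟩
    have : (r • S - algebraMap ℂ 𝒜 z) * (r⁻¹ • T) = u := by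
      rw [hu, sub_mul, smul_mul_smul_comm, hST, mul_inv_cancel₀ hr, one_smul,
        ← Algebra.smul_def, smul_smul, div_eq_mul_inv]
    rw [← mul_assoc, this, Units.mul_inv]
  · have hz0 : z ≠ 0 := norm_pos_iff.mp ((norm_nonneg r).trans_lt h)
    have hlt : ‖(r / z) • S‖ < 1 := by
      calc ‖(r / z) • S‖ ≤ ‖r / z‖ * ‖S‖ := norm_smul_le _ _
        _ ≤ ‖r / z‖ * 1 := by gcongr
        _ < 1 := by
          rw [mul_one, norm_div, div_lt_one (norm_pos_iff.mpr hz0)]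
          exact h
    obtain ⟨u, hu⟩ := isUnit_one_sub_of_norm_lt_one hlt
    refine ⟨(-z)⁻¹ • (u⁻¹ : 𝒜ˣ), ?_⟩
    have : r • S - algebraMap ℂ 𝒜 z = (-z) • (u : 𝒜) := by
      rw [hu, smul_sub, smul_smul, Algebra.algebraMap_eq_smul_one, neg_mul, mul_div_cancel₀ _ hz0]
      simp only [neg_smul]
      abel
    rw [this, smul_mul_smul_comm, mul_inv_cancel₀ (neg_ne_zero.mpr hz0), Units.mul_inv, one_smul]

open Polynomial in
theorem Polynomial.exists_aeval_prod_mul_eq_one {𝒜 : Type*} [Ring 𝒜] [Algebra ℂ 𝒜] (x : 𝒜)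
    (m : Multiset ℂ) (h : ∀ z ∈ m, ∃ G : 𝒜, (x - algebraMap ℂ 𝒜 z) * G = 1) :
    ∃ G : 𝒜, aeval x (m.map fun z => X - C z).prod * G = 1 := by
  induction m using Multiset.induction with
  | empty => exact ⟨1, by simp⟩
  | cons z m ih =>
    obtain ⟨G, hG⟩ := h z (Multiset.mem_cons_self z m)
    obtain ⟨G', hG'⟩ := ih fun w hw => h w (Multiset.mem_cons_of_mem hw)
    refine ⟨G' * G, ?_⟩
    rw [Multiset.map_cons, Multiset.prod_cons, map_mul, map_sub, aeval_X, aeval_C, mul_assoc,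
      ← mul_assoc (aeval x _) G' G, hG', one_mul, hG]

open Polynomial in
theorem Commute.sub_dvd_aeval_sub_aeval {K 𝒜 : Type*} [CommRing K] [Ring 𝒜] [Algebra K 𝒜]
    {x y : 𝒜} (h : Commute x y) (p : K[X]) : x - y ∣ aeval x p - aeval y p := by
  induction p using Polynomial.induction_on' with
  | add p q hp hq =>
    rw [map_add, map_add, add_sub_add_comm]
    exact dvd_add hp hq
  | monomial n k =>
    obtain ⟨d, hd⟩ := h.sub_dvd_pow_sub_pow n
    refine ⟨k • d, ?_⟩
    rw [aeval_monomial, aeval_monomial, ← mul_sub, hd, ← Algebra.smul_def, mul_smul_comm]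

open Polynomial in
/-- If a monic polynomial annihilates `B`, and `x - z` is right invertible for each of its roots
`z`, then `x - B` is right invertible for every `x` commuting with `B`. -/
theorem Commute.exists_sub_mul_eq_one {𝒜 : Type*} [Ring 𝒜] [Algebra ℂ 𝒜]
    {x B : 𝒜} (hxB : Commute x B) {p : ℂ[X]} (hp : p.Monic) (hpB : aeval B p = 0)
    (h : ∀ z ∈ p.roots, ∃ G : 𝒜, (x - algebraMap ℂ 𝒜 z) * G = 1) :
    ∃ G : 𝒜, (x - B) * G = 1 := by
  obtain ⟨G, hG⟩ := exists_aeval_prod_mul_eq_one x p.roots h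
  rw [← (IsAlgClosed.splits p).eq_prod_roots_of_monic hp] at hG
  obtain ⟨d, hd⟩ := hxB.sub_dvd_aeval_sub_aeval p
  rw [hpB, sub_zero] at hd
  exact ⟨d * G, by rw [← mul_assoc, ← hd, hG]⟩

open scoped BoundedContinuousFunction

/-- Left shift on bounded sequences. -/
noncomputable def leftShift (E : Type*) [NormedAddCommGroup E] [NormedSpace ℂ E] :
    (ℕ →ᵇ E) →L[ℂ] (ℕ →ᵇ E) :=
  LinearMap.mkContinuous
    { toFun := fun u => BoundedContinuousFunction.ofNormedAddCommGroupDiscrete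
        (fun n => u (n + 1)) ‖u‖ fun n => u.norm_coe_le_norm (n + 1)
      map_add' := fun _ _ => rfl
      map_smul' := fun _ _ => rfl } 1 fun u => by
    rw [one_mul]
    exact (BoundedContinuousFunction.norm_le (norm_nonneg u)).mpr
      fun n => u.norm_coe_le_norm (n + 1)

/-- Right shift on bounded sequences, inserting `0` in front. -/
noncomputable def rightShift (E : Type*) [NormedAddCommGroup E] [NormedSpace ℂ E] :
    (ℕ →ᵇ E) →L[ℂ] (ℕ →ᵇ E) :=
  have bound (u : ℕ →ᵇ E) (n : ℕ) : ‖(n.casesOn 0 u : E)‖ ≤ ‖u‖ := by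
    cases n with
    | zero => simp
    | succ n => exact u.norm_coe_le_norm n
  LinearMap.mkContinuous
    { toFun := fun u => BoundedContinuousFunction.ofNormedAddCommGroupDiscrete
        (fun n => n.casesOn 0 u) ‖u‖ (bound u)
      map_add' := fun u v => by ext n; cases n <;> simp
      map_smul' := fun k u => by ext n; cases n <;> simp } 1 (fun u => by
    rw [one_mul]
    exact (BoundedContinuousFunction.norm_le (norm_nonneg u)).mpr (bound u))

theorem leftShift_apply {E : Type*} [NormedAddCommGroup E] [NormedSpace ℂ E]
    (u : ℕ →ᵇ E) (n : ℕ) : leftShift E u n = u (n + 1) := rfl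

theorem norm_leftShift_le (E : Type*) [NormedAddCommGroup E] [NormedSpace ℂ E] :
    ‖leftShift E‖ ≤ 1 := LinearMap.mkContinuous_norm_le _ zero_le_one _

theorem norm_rightShift_le (E : Type*) [NormedAddCommGroup E] [NormedSpace ℂ E] :
    ‖rightShift E‖ ≤ 1 := by
  refine ContinuousLinearMap.opNorm_le_bound _ zero_le_one fun u => ?_
  rw [one_mul]
  refine (BoundedContinuousFunction.norm_le (norm_nonneg u)).mpr fun n => ?_
  cases n with
  | zero => exact norm_zero.trans_le (norm_nonneg u)
  | succ n => exact u.norm_coe_le_norm n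

theorem leftShift_mul_rightShift (E : Type*) [NormedAddCommGroup E] [NormedSpace ℂ E] :
    leftShift E * rightShift E = 1 := rfl

/-- Termwise action of a bounded sequence of matrices on bounded sequences of vectors. -/
noncomputable def diagMulVec {N : ℕ} (D : ℕ → Matrix (Fin N) (Fin N) ℂ) (K : ℝ)
    (hD : ∀ n, ‖D n‖ ≤ K) : (ℕ →ᵇ (Fin N → ℂ)) →L[ℂ] (ℕ →ᵇ (Fin N → ℂ)) :=
  have bound (u : ℕ →ᵇ (Fin N → ℂ)) (n : ℕ) : ‖(D n).mulVec (u n)‖ ≤ K * ‖u‖ :=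
    (Matrix.linfty_opNorm_mulVec (D n) (u n)).trans
      (mul_le_mul (hD n) (u.norm_coe_le_norm n) (norm_nonneg _) ((norm_nonneg _).trans (hD n)))
  LinearMap.mkContinuous
    { toFun := fun u => BoundedContinuousFunction.ofNormedAddCommGroupDiscrete
        (fun n => (D n).mulVec (u n)) (K * ‖u‖) (bound u)
      map_add' := fun u v => by ext1 n; exact Matrix.mulVec_add (D n) (u n) (v n)
      map_smul' := fun k u => by ext1 n; exact Matrix.mulVec_smul (D n) k (u n) } K fun u =>
    (BoundedContinuousFunction.norm_le
      (mul_nonneg ((norm_nonneg _).trans (hD 0)) (norm_nonneg u))).mpr (bound u)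

theorem diagMulVec_apply {N : ℕ} (D : ℕ → Matrix (Fin N) (Fin N) ℂ) (K : ℝ)
    (hD : ∀ n, ‖D n‖ ≤ K) (u : ℕ →ᵇ (Fin N → ℂ)) (n : ℕ) :
    diagMulVec D K hD u n = (D n).mulVec (u n) := rfl

theorem norm_diagMulVec_le {N : ℕ} (D : ℕ → Matrix (Fin N) (Fin N) ℂ) (K : ℝ)
    (hD : ∀ n, ‖D n‖ ≤ K) : ‖diagMulVec D K hD‖ ≤ K :=
  have hK : 0 ≤ K := (norm_nonneg _).trans (hD 0)
  ContinuousLinearMap.opNorm_le_bound _ hK fun u =>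
    (BoundedContinuousFunction.norm_le (mul_nonneg hK (norm_nonneg u))).mpr fun n =>
      (Matrix.linfty_opNorm_mulVec (D n) (u n)).trans
        (mul_le_mul (hD n) (u.norm_coe_le_norm n) (norm_nonneg _) hK)

theorem aeval_diagMulVec_const_apply {N : ℕ} (M : Matrix (Fin N) (Fin N) ℂ)
    (p : Polynomial ℂ) (u : ℕ →ᵇ (Fin N → ℂ)) (n : ℕ) :
    Polynomial.aeval (diagMulVec (fun _ => M) ‖M‖ fun _ => le_rfl) p u n =
      (Polynomial.aeval M p).mulVec (u n) := by
  set B := diagMulVec (fun _ => M) ‖M‖ fun _ => le_rfl with hB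
  have hpow : ∀ k : ℕ, (B ^ k) u n = (M ^ k).mulVec (u n) := by
    intro k
    induction k with
    | zero => simp
    | succ k ih =>
      rw [pow_succ', mul_apply_eq_comp, hB, diagMulVec_apply, ← hB, ih,
        Matrix.mulVec_mulVec, ← pow_succ']
  induction p using Polynomial.induction_on' with
  | add p q hp hq =>
    rw [map_add, map_add, add_apply, BoundedContinuousFunction.add_apply,
      hp, hq, Matrix.add_mulVec]
  | monomial k z =>
    rw [Polynomial.aeval_monomial, Polynomial.aeval_monomial, ← Algebra.smul_def,
      ← Algebra.smul_def, smul_apply, BoundedContinuousFunction.smul_apply,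
      hpow, Matrix.smul_mulVec]

theorem exists_smul_leftShift_sub_mul_eq_one {N : ℕ} (M : Matrix (Fin N) (Fin N) ℂ) {r : ℂ}
    (hr : r ≠ 0) (h : ∀ z ∈ M.charpoly.roots, ‖z‖ ≠ ‖r‖) :
    ∃ G, (r • leftShift (Fin N → ℂ) - diagMulVec (fun _ => M) ‖M‖ fun _ => le_rfl) * G = 1 := by
  refine Commute.exists_sub_mul_eq_one (p := M.charpoly) ?_ M.charpoly_monic ?_ fun z hz =>
    exists_smul_sub_algebraMap_mul_eq_one (leftShift_mul_rightShift _) (norm_leftShift_le _)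
      (norm_rightShift_le _) hr (h z hz)
  · refine Commute.smul_left ?_ r
    rfl
  · ext1 u
    ext1 n
    rw [aeval_diagMulVec_const_apply, Matrix.aeval_self_charpoly, Matrix.zero_mulVec]
    rfl

theorem exists_forall_int_mulVec {N : ℕ} {Mseq : ℤ → Matrix (Fin N) (Fin N) ℂ}
    (hMseq : ∀ j : ℤ, IsUnit (Mseq j)) (J : ℤ) (w : Fin N → ℂ) :
    ∃ W : ℤ → Fin N → ℂ, W J = w ∧ ∀ j : ℤ, W (j + 1) = (Mseq j).mulVec (W j) := by
  refine ⟨fun j => Int.inductionOn' (motive := fun _ => Fin N → ℂ) j J w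
    (fun k _ v => (Mseq k).mulVec v) (fun k _ v => (Mseq (k - 1))⁻¹.mulVec v), ?_, fun j => ?_⟩
  · exact Int.inductionOn'_self
  · rcases le_or_gt J j with h | h
    · exact Int.inductionOn'_add_one h
    · have := Int.inductionOn'_sub_one (motive := fun _ => Fin N → ℂ) (b := J) (zero := w)
        (succ := fun k _ v => (Mseq k).mulVec v) (pred := fun k _ v => (Mseq (k - 1))⁻¹.mulVec v)
        (z := j + 1) (by omega)
      rw [add_sub_cancel_right] at this
      dsimp only
      rw [this, Matrix.mulVec_mulVec,
        Matrix.mul_nonsing_inv _ ((Matrix.isUnit_iff_isUnit_det _).mp (hMseq j)),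
        Matrix.one_mulVec]

theorem exists_mem_Ioo_forall_norm_ne {a : ℝ} (ha : 0 < a) {ζ : ℂ} (hζ : ζ ≠ 0)
    (m : Multiset ℂ) :
    ∃ c ∈ Set.Ioo 0 a, ∀ z ∈ m, ‖z‖ ≠ ‖ζ * Real.exp (-c)‖ := by
  have hfin : ((m.toFinset.image fun z => -Real.log (‖z‖ / ‖ζ‖) : Finset ℝ) : Set ℝ).Finite :=
    Finset.finite_toSet _
  obtain ⟨c, hc, hcm⟩ := (Set.Ioo_infinite ha).exists_notMem_finite hfin
  refine ⟨c, hc, fun z hz h => hcm ?_⟩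
  simp only [Finset.coe_image, Set.mem_image, Finset.mem_coe, Multiset.mem_toFinset]
  refine ⟨z, hz, ?_⟩
  rw [h, norm_mul, mul_div_cancel_left₀ _ (norm_ne_zero_iff.mpr hζ), Complex.norm_real,
    Real.norm_of_nonneg (Real.exp_pos _).le, Real.log_exp, neg_neg]

theorem stmt11 (N : ℕ) (hN : 1 ≤ N)
    (Mseq : ℤ → Matrix (Fin N) (Fin N) ℂ) (hMseq : ∀ j : ℤ, IsUnit (Mseq j))
    (M : Matrix (Fin N) (Fin N) ℂ) (hM : IsUnit M)
    (C₀ a : ℝ) (hC₀ : 0 < C₀) (ha : 0 < a)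
    (hconv : ∀ j : ℕ, ‖Mseq (j : ℤ) - M‖ ≤ C₀ * Real.exp (-a * j))
    (ζ : ℂ) (hζ : ζ ≠ 0) (R : Fin N → ℂ) (hR : R ≠ 0) (hEig : M.mulVec R = ζ • R) :
    ∃ C c : ℝ, 0 < C ∧ 0 < c ∧ ∃ W : ℤ → Fin N → ℂ,
      (∀ j : ℤ, W (j + 1) = (Mseq j).mulVec (W j)) ∧
      ∀ j : ℕ, ‖ζ ^ (-(j : ℤ)) • W (j : ℤ) - R‖ ≤ C * Real.exp (-c * j) := by
  obtain ⟨c, ⟨hc0, hca⟩, hc⟩ := exists_mem_Ioo_forall_norm_ne ha hζ M.charpoly.roots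
  set r : ℂ := ζ * Real.exp (-c) with hr_def
  have hexp (t : ℝ) : (Real.exp t : ℂ) ≠ 0 := Complex.ofReal_ne_zero.mpr (Real.exp_pos t).ne'
  have hr : r ≠ 0 := mul_ne_zero hζ (hexp _)
  obtain ⟨G, hG⟩ := exists_smul_leftShift_sub_mul_eq_one M hr hc
  have hlim : Filter.Tendsto (fun j : ℕ => C₀ * Real.exp (-a * j) * ‖G‖) Filter.atTop
      (nhds 0) := by
    have : Filter.Tendsto (fun j : ℕ => Real.exp (-a * j)) Filter.atTop (nhds 0) :=
      Real.tendsto_exp_atBot.comp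
        (tendsto_natCast_atTop_atTop.const_mul_atTop_of_neg (neg_neg_of_pos ha))
    simpa using (this.const_mul C₀).mul_const ‖G‖
  obtain ⟨J, hJ⟩ := (hlim.eventually_lt_const one_pos).exists
  -- the remainder `Mseq - M` after time `J`, as an operator and as a forcing term
  have hE (n : ℕ) : ‖Mseq ((J + n : ℕ) : ℤ) - M‖ ≤ C₀ * Real.exp (-a * J) := by
    refine (hconv (J + n)).trans ?_
    gcongr C₀ * Real.exp ?_
    push_cast
    nlinarith [mul_nonneg ha.le (Nat.cast_nonneg (α := ℝ) n)]
  set E := diagMulVec (fun n => Mseq ((J + n : ℕ) : ℤ) - M) _ hE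
  have hEG : ‖E * G‖ < 1 :=
    ((norm_mul_le _ _).trans
      (mul_le_mul_of_nonneg_right (norm_diagMulVec_le _ _ hE) (norm_nonneg G))).trans_lt hJ
  obtain ⟨v, hv⟩ : IsUnit (1 - E * G) :=
    isUnit_one_sub_of_norm_lt_one (R := (ℕ →ᵇ (Fin N → ℂ)) →L[ℂ] (ℕ →ᵇ (Fin N → ℂ))) hEG
  have hf (n : ℕ) : ‖(Real.exp (c * (J + n : ℕ)) : ℂ) •
      (Mseq ((J + n : ℕ) : ℤ) - M).mulVec R‖ ≤ C₀ * ‖R‖ := by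
    rw [norm_smul, Complex.norm_real, Real.norm_of_nonneg (Real.exp_pos _).le]
    calc Real.exp (c * (J + n : ℕ)) * ‖(Mseq ((J + n : ℕ) : ℤ) - M).mulVec R‖
        ≤ Real.exp (c * (J + n : ℕ)) * (C₀ * Real.exp (-a * (J + n : ℕ)) * ‖R‖) := by
          gcongr
          exact (Matrix.linfty_opNorm_mulVec _ _).trans
            (mul_le_mul_of_nonneg_right (hconv _) (norm_nonneg R))
      _ = Real.exp ((c - a) * (J + n : ℕ)) * (C₀ * ‖R‖) := by
          rw [sub_mul, sub_eq_add_neg, ← neg_mul, Real.exp_add]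
          ring
      _ ≤ 1 * (C₀ * ‖R‖) := by
          gcongr
          rw [Real.exp_le_one_iff]
          exact mul_nonpos_of_nonpos_of_nonneg (by linarith) (Nat.cast_nonneg _)
      _ = C₀ * ‖R‖ := one_mul _
  set f : ℕ →ᵇ (Fin N → ℂ) :=
    BoundedContinuousFunction.ofNormedAddCommGroupDiscrete _ _ hf
  set y : ℕ →ᵇ (Fin N → ℂ) := G ((v⁻¹ : (_)ˣ).val f)
  have hy : (r • leftShift (Fin N → ℂ) - (diagMulVec (fun _ => M) ‖M‖ fun _ => le_rfl) - E) y
      = f := by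
    have h1 : (r • leftShift (Fin N → ℂ) - (diagMulVec (fun _ => M) ‖M‖ fun _ => le_rfl) - E)
        * (G * (v⁻¹ : (_)ˣ).val) = 1 := by
      rw [← mul_assoc, sub_mul, hG, ← hv, Units.mul_inv]
    exact DFunLike.congr_fun h1 f
  have hstep (n : ℕ) : r • y (n + 1) = (Mseq ((J + n : ℕ) : ℤ)).mulVec (y n) +
      (Real.exp (c * (J + n : ℕ)) : ℂ) • (Mseq ((J + n : ℕ) : ℤ) - M).mulVec R := by
    have h2 : r • y (n + 1) - M.mulVec (y n) - (Mseq ((J + n : ℕ) : ℤ) - M).mulVec (y n) =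
        (Real.exp (c * (J + n : ℕ)) : ℂ) • (Mseq ((J + n : ℕ) : ℤ) - M).mulVec R :=
      DFunLike.congr_fun hy n
    rw [← h2, Matrix.sub_mulVec]
    abel
  obtain ⟨W, hWJ, hW⟩ := exists_forall_int_mulVec hMseq J (ζ ^ J • R + r ^ J • y 0)
  have hrpow (k : ℕ) : r ^ k * (Real.exp (c * k) : ℂ) = ζ ^ k := by
    rw [hr_def, mul_pow, mul_assoc, ← Complex.ofReal_pow, ← Complex.ofReal_mul,
      ← Real.exp_nat_mul, ← Real.exp_add]
    have : (k : ℝ) * -c + c * k = 0 := by ring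
    rw [this, Real.exp_zero, Complex.ofReal_one, mul_one]
  have hWy (n : ℕ) : W ((J + n : ℕ) : ℤ) = ζ ^ (J + n) • R + r ^ (J + n) • y n := by
    induction n with
    | zero => exact hWJ
    | succ n ih =>
      have hcast : ((J + (n + 1) : ℕ) : ℤ) = ((J + n : ℕ) : ℤ) + 1 := by push_cast; ring
      rw [hcast, hW, ih, ← add_assoc, pow_succ r, mul_smul, hstep, smul_add, smul_smul, hrpow,
        Matrix.mulVec_add, Matrix.mulVec_smul, Matrix.mulVec_smul, Matrix.sub_mulVec, hEig,
        smul_sub, smul_smul, ← pow_succ]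
      abel
  have hO : (fun j : ℕ => ζ ^ (-(j : ℤ)) • W (j : ℤ) - R) =O[Filter.atTop]
      fun j : ℕ => Real.exp (-c * j) := by
    refine Asymptotics.IsBigO.of_bound ‖y‖ ?_
    filter_upwards [Filter.eventually_ge_atTop J] with j hj
    obtain ⟨n, rfl⟩ := Nat.exists_eq_add_of_le hj
    have h3 : ζ ^ (-((J + n : ℕ) : ℤ)) • W ((J + n : ℕ) : ℤ) - R =
        (Real.exp (-c * (J + n : ℕ)) : ℂ) • y n := by
      rw [hWy, zpow_neg, zpow_natCast, smul_add, smul_smul, smul_smul,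
        inv_mul_cancel₀ (pow_ne_zero _ hζ), one_smul, add_sub_cancel_left, hr_def, mul_pow,
        inv_mul_cancel_left₀ (pow_ne_zero _ hζ), ← Complex.ofReal_pow, ← Real.exp_nat_mul,
        mul_comm (((J + n : ℕ) : ℝ))]
    rw [h3, norm_smul, Complex.norm_real, mul_comm]
    exact mul_le_mul_of_nonneg_right (y.norm_coe_le_norm n) (norm_nonneg _)
  obtain ⟨C, hC, hbound⟩ := Asymptotics.bound_of_isBigO_nat_atTop hO
  refine ⟨C, c, hC, hc0, W, hW, fun j => ?_⟩
  have := hbound (x := j) (Real.exp_pos _).ne'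
  rwa [Real.norm_of_nonneg (Real.exp_pos _).le] at this
end
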